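/- Let P be a finite nonempty labelled point set in ℝ^d that is in general position. Then every reduced training set Q of (P,c) contains every relevant point of P; that is, rel(P) ⊆ Q. -/

import Mathlib

open Set

/-- The nearest-neighbor classification induced by a labelled point set `(P, c)` in `ℝ^d`:
`nnClass P c q` is the set of labels of nearest neighbors of `q` in `P`. -/
def nnClass {d : ℕ} {L : Type*} (P : Set (EuclideanSpace ℝ (Fin d)))
    (c : EuclideanSpace ℝ (Fin d) → L) (q : EuclideanSpace ℝ (Fin d)) : Set L :=
  {l | ∃ p ∈ P, (∀ p' ∈ P, dist q p ≤ dist q p') ∧ c p = l}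

/-- `Q` is a reduced training set of `(P, c)`. -/
def IsRTS {d : ℕ} {L : Type*} (P : Set (EuclideanSpace ℝ (Fin d)))
    (c : EuclideanSpace ℝ (Fin d) → L) (Q : Set (EuclideanSpace ℝ (Fin d))) : Prop :=
  Q ⊆ P ∧ nnClass Q c = nnClass P c

/-- The set of relevant points of `(P, c)`. -/
def relPts {d : ℕ} {L : Type*} (P : Set (EuclideanSpace ℝ (Fin d)))
    (c : EuclideanSpace ℝ (Fin d) → L) : Set (EuclideanSpace ℝ (Fin d)) :=
  {p | p ∈ P ∧ nnClass (P \ {p}) c ≠ nnClass P c}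

/-- `P` is in general position: no three points of `P` are collinear
and no four points of `P` are concyclic. -/
def GenPos {d : ℕ} (P : Set (EuclideanSpace ℝ (Fin d))) : Prop :=
  (∀ s ⊆ P, s.ncard = 3 → ¬ Collinear ℝ s) ∧
  (∀ s ⊆ P, s.ncard = 4 → ¬ EuclideanGeometry.Concyclic s)

/-- The bisecting hyperplane (perpendicular bisector) of two points. -/
def bis {d : ℕ} (a b : EuclideanSpace ℝ (Fin d)) : Set (EuclideanSpace ℝ (Fin d)) :=
  {x | dist x a = dist x b}

open Filter Topology

/-- The points of `P` at minimal distance from `q`. -/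
def nearestPts {d : ℕ} (P : Set (EuclideanSpace ℝ (Fin d))) (q : EuclideanSpace ℝ (Fin d)) :
    Set (EuclideanSpace ℝ (Fin d)) :=
  {p | p ∈ P ∧ ∀ p' ∈ P, dist q p ≤ dist q p'}

theorem nnClass_eq_image {d : ℕ} {L : Type*} (P : Set (EuclideanSpace ℝ (Fin d)))
    (c : EuclideanSpace ℝ (Fin d) → L) (q : EuclideanSpace ℝ (Fin d)) :
    nnClass P c q = c '' nearestPts P q := by
  ext l
  simp [nnClass, nearestPts, and_assoc]

theorem nearestPts_nonempty {d : ℕ} {P : Set (EuclideanSpace ℝ (Fin d))} (hfin : P.Finite)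
    (hne : P.Nonempty) (q : EuclideanSpace ℝ (Fin d)) : (nearestPts P q).Nonempty := by
  obtain ⟨p, hp, h⟩ := Set.exists_min_image P (dist q) hfin hne
  exact ⟨p, hp, h⟩

theorem eventually_nearestPts_subset {d : ℕ} {P : Set (EuclideanSpace ℝ (Fin d))}
    (hfin : P.Finite) (x : EuclideanSpace ℝ (Fin d)) :
    ∀ᶠ y in 𝓝 x, nearestPts P y ⊆ nearestPts P x := by
  have key : ∀ a ∈ P, ∀ᶠ y in 𝓝 x, a ∈ nearestPts P y → a ∈ nearestPts P x := by
    intro a ha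
    by_cases h : a ∈ nearestPts P x
    · exact Eventually.of_forall fun _ _ => h
    · obtain ⟨p', hp', hlt⟩ : ∃ p' ∈ P, dist x p' < dist x a := by
        by_contra! hcon
        exact h ⟨ha, hcon⟩
      have hev : ∀ᶠ y in 𝓝 x, dist y p' < dist y a :=
        (continuous_id.dist continuous_const).continuousAt.eventually_lt
          (continuous_id.dist continuous_const).continuousAt hlt
      filter_upwards [hev] with y hy hya
      exact absurd (hya.2 p' hp') (not_le.mpr hy)
  filter_upwards [(hfin.eventually_all).2 key] with y hy a ha
  exact hy a ha.1 ha

theorem dist_sq_sub_dist_sq_lineMap {V : Type*} [NormedAddCommGroup V] [InnerProductSpace ℝ V]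
    (x y a b : V) (t : ℝ) :
    dist (AffineMap.lineMap x y t) a ^ 2 - dist (AffineMap.lineMap x y t) b ^ 2 =
      (1 - t) * (dist x a ^ 2 - dist x b ^ 2) + t * (dist y a ^ 2 - dist y b ^ 2) := by
  simp only [dist_eq_norm, AffineMap.lineMap_apply_module', @norm_sub_sq_real V, inner_add_left,
    inner_smul_left, inner_sub_left, RCLike.conj_to_real]
  ring

/-- If `p` is at least as close to `x` as `a`, then it is strictly closer than `a` to every other
point of the segment from `x` to `p`. -/
theorem dist_lineMap_lt {V : Type*} [NormedAddCommGroup V] [InnerProductSpace ℝ V]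
    {x p a : V} (h : dist x p ≤ dist x a) (hne : p ≠ a) {t : ℝ} (ht0 : 0 < t) (ht1 : t ≤ 1) :
    dist (AffineMap.lineMap x p t) p < dist (AffineMap.lineMap x p t) a := by
  have h1 := dist_sq_sub_dist_sq_lineMap x p a p t
  have h2 : 0 < dist p a := dist_pos.2 hne
  have h3 : dist x p ^ 2 ≤ dist x a ^ 2 := by gcongr
  rw [dist_self] at h1
  refine lt_of_pow_lt_pow_left₀ 2 dist_nonneg ?_
  have h4 : 0 ≤ (1 - t) * (dist x a ^ 2 - dist x p ^ 2) :=
    mul_nonneg (by linarith) (by linarith)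
  have h5 : 0 < t * dist p a ^ 2 := by positivity
  nlinarith

/-- A point of `P` with `p` as unique nearest neighbor and second nearest neighbor `b` yields a
point whose nearest neighbors are exactly `p` and `b`. -/
theorem exists_equidistant_of_second_nearest {d : ℕ} {P : Set (EuclideanSpace ℝ (Fin d))}
    {p b q : EuclideanSpace ℝ (Fin d)} (hb : b ∈ nearestPts (P \ {p}) q)
    (hlt : dist q p < dist q b) :
    ∃ x, dist x p = dist x b ∧ ∀ a ∈ P, a ≠ p → a ≠ b → dist x b < dist x a := by
  have hpb : b ≠ p := hb.1.2
  set f : ℝ → ℝ := fun t =>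
    dist (AffineMap.lineMap q b t) p - dist (AffineMap.lineMap q b t) b with hf
  have hcont : Continuous f := by
    have : Continuous fun t : ℝ => (AffineMap.lineMap q b t : EuclideanSpace ℝ (Fin d)) :=
      AffineMap.lineMap_continuous
    exact (this.dist continuous_const).sub (this.dist continuous_const)
  have hmem : (0 : ℝ) ∈ Set.Icc (f 0) (f 1) := by
    simp only [hf, AffineMap.lineMap_apply_zero, AffineMap.lineMap_apply_one, dist_self]
    exact ⟨by linarith, by simp⟩
  obtain ⟨t, ⟨ht0, ht1⟩, ht⟩ := intermediate_value_Icc zero_le_one hcont.continuousOn hmem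
  have ht0' : 0 < t := by
    refine lt_of_le_of_ne ht0 fun h => ?_
    subst h
    simp only [hf, AffineMap.lineMap_apply_zero] at ht
    linarith
  refine ⟨AffineMap.lineMap q b t, sub_eq_zero.1 ht, fun a ha hap hab => ?_⟩
  exact dist_lineMap_lt (hb.2 a ⟨ha, hap⟩) hab.symm ht0' ht1

/-- A relevant point is a nearest neighbor, together with exactly one point of another label, of
some point of the space. -/
theorem exists_wall_of_mem_relPts {d : ℕ} {L : Type*} {P : Set (EuclideanSpace ℝ (Fin d))}
    {c : EuclideanSpace ℝ (Fin d) → L} (hfin : P.Finite) {p : EuclideanSpace ℝ (Fin d)}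
    (hp : p ∈ relPts P c) (hne : (P \ {p}).Nonempty) :
    ∃ x, ∃ b ∈ P, c b ≠ c p ∧ dist x p = dist x b ∧
      ∀ a ∈ P, a ≠ p → a ≠ b → dist x b < dist x a := by
  have hfin' : (P \ {p}).Finite := hfin.sdiff
  suffices h : ∃ q, ∃ b ∈ nearestPts (P \ {p}) q, c b ≠ c p ∧ dist q p < dist q b by
    obtain ⟨q, b, hb, hc, hlt⟩ := h
    obtain ⟨x, hx⟩ := exists_equidistant_of_second_nearest hb hlt
    exact ⟨x, b, hb.1.1, hc, hx⟩
  obtain ⟨q, hq⟩ := Function.ne_iff.1 hp.2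
  rw [nnClass_eq_image, nnClass_eq_image] at hq
  by_cases hstrict : ∃ b ∈ nearestPts (P \ {p}) q, c b ≠ c p ∧ dist q p < dist q b
  · exact ⟨q, hstrict⟩
  push Not at hstrict
  obtain ⟨b₀, hb₀⟩ := nearestPts_nonempty hfin' hne q
  have hle : dist q p ≤ dist q b₀ := by
    by_contra! hlt
    refine hq (congrArg (c '' ·) (Set.ext fun a => ⟨fun ha => ⟨ha.1.1, fun p' hp' => ?_⟩,
      fun ha => ⟨⟨ha.1, ?_⟩, fun p' hp' => ha.2 p' hp'.1⟩⟩))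
    · by_cases h : p' = p
      · exact h ▸ (ha.2 b₀ hb₀.1).trans hlt.le
      · exact ha.2 p' ⟨hp', h⟩
    · rintro rfl
      exact absurd (ha.2 b₀ hb₀.1.1) (not_le.mpr hlt)
  have hpq : p ∈ nearestPts P q := by
    refine ⟨hp.1, fun p' hp' => ?_⟩
    by_cases h : p' = p
    · rw [h]
    · exact hle.trans (hb₀.2 p' ⟨hp', h⟩)
  have hcol : ∀ a ∈ nearestPts (P \ {p}) q, c a ≠ c p := by
    intro a ha hca
    refine hq (Set.Subset.antisymm ?_ ?_)
    · rintro _ ⟨e, he, rfl⟩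
      by_cases hce : c e = c p
      · exact ⟨p, hpq, hce.symm⟩
      · exact ⟨e, ⟨he.1.1, fun p' hp' => (hstrict e he hce).trans (hpq.2 p' hp')⟩, rfl⟩
    · rintro _ ⟨e, he, rfl⟩
      by_cases hep : e = p
      · exact ⟨a, ha, by rw [hca, hep]⟩
      · exact ⟨e, ⟨⟨he.1, hep⟩, fun p' hp' => he.2 p' hp'.1⟩, rfl⟩
  have htend : Tendsto (fun t : ℝ => (AffineMap.lineMap q p t : EuclideanSpace ℝ (Fin d)))
      (𝓝[>] 0) (𝓝 q) := by
    have h := (AffineMap.lineMap_continuous (R := ℝ) (p := q) (q := p)).tendsto 0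
    rw [AffineMap.lineMap_apply_zero] at h
    exact h.mono_left nhdsWithin_le_nhds
  obtain ⟨t, hsub, ht0, ht1⟩ := ((htend.eventually (eventually_nearestPts_subset hfin' q)).and
    (Ioc_mem_nhdsGT zero_lt_one)).exists
  obtain ⟨b, hb⟩ := nearestPts_nonempty hfin' hne (AffineMap.lineMap q p t)
  exact ⟨_, b, hb, hcol b (hsub hb),
    dist_lineMap_lt (hpq.2 b hb.1.1) (Ne.symm hb.1.2) ht0 ht1⟩

/-- The vertices of an isosceles trapezoid with parallel sides in direction `u` and axis in
direction `v` are concyclic. -/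
theorem concyclic_isosceles_trapezoid {V : Type*} [NormedAddCommGroup V] [InnerProductSpace ℝ V]
    {m u v : V} (huv : inner ℝ u v = 0) (hv : v ≠ 0) (k : ℝ) :
    EuclideanGeometry.Concyclic ({m + u, m - u, m + v + k • u, m + v - k • u} : Set V) := by
  constructor
  · have hv2 : ‖v‖ ^ 2 ≠ 0 := by simpa using hv
    set s : ℝ := (1 + (k ^ 2 - 1) * ‖u‖ ^ 2 / ‖v‖ ^ 2) / 2 with hs
    have hsv : (2 * s - 1) * ‖v‖ ^ 2 = (k ^ 2 - 1) * ‖u‖ ^ 2 := by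
      rw [hs]
      field_simp
      ring
    have norm_comb : ∀ α β : ℝ, ‖α • u + β • v‖ ^ 2 = α ^ 2 * ‖u‖ ^ 2 + β ^ 2 * ‖v‖ ^ 2 := by
      intro α β
      rw [norm_add_sq_real, inner_smul_left, inner_smul_right, huv, norm_smul, norm_smul,
        mul_pow, mul_pow, Real.norm_eq_abs, Real.norm_eq_abs, sq_abs, sq_abs]
      simp
    have hdist : ∀ z : V, ∀ α β : ℝ, z - (m + s • v) = α • u + β • v →
        α ^ 2 * ‖u‖ ^ 2 + β ^ 2 * ‖v‖ ^ 2 = ‖u‖ ^ 2 + s ^ 2 * ‖v‖ ^ 2 →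
        dist z (m + s • v) = √(‖u‖ ^ 2 + s ^ 2 * ‖v‖ ^ 2) := by
      intro z α β hz h
      rw [dist_eq_norm, hz, ← h, ← norm_comb, Real.sqrt_sq (norm_nonneg _)]
    refine ⟨m + s • v, √(‖u‖ ^ 2 + s ^ 2 * ‖v‖ ^ 2), ?_⟩
    rintro z (rfl | rfl | rfl | rfl)
    · exact hdist _ 1 (-s) (by module) (by ring)
    · exact hdist _ (-1) (-s) (by module) (by ring)
    · exact hdist _ k (1 - s) (by module) (by linear_combination -hsv)
    · exact hdist _ (-k) (1 - s) (by module) (by linear_combination -hsv)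
  · have hle : vectorSpan ℝ ({m + u, m - u, m + v + k • u, m + v - k • u} : Set V) ≤
        Submodule.span ℝ {u, v} := by
      rw [vectorSpan_eq_span_vsub_set_right ℝ (Set.mem_insert (m + u) _), Submodule.span_le]
      rintro _ ⟨z, (rfl | rfl | rfl | rfl), rfl⟩ <;>
        simp only [vsub_eq_sub, SetLike.mem_coe, Submodule.mem_span_pair]
      · exact ⟨0, 0, by module⟩
      · exact ⟨-2, 0, by module⟩
      · exact ⟨k - 1, 1, by module⟩
      · exact ⟨-k - 1, 1, by module⟩
    refine (Submodule.rank_mono hle).trans ((rank_span_le _).trans ?_)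
    classical
    exact (Cardinal.mk_insert_le).trans (by
      rw [Cardinal.mk_singleton]
      norm_num)

/-- Two pairs of distinct points with parallel difference vectors and a common equidistant-point
hyperplane in a set in general position coincide. -/
theorem GenPos.eq_of_parallel {d : ℕ} {P : Set (EuclideanSpace ℝ (Fin d))} (hgp : GenPos P)
    {x p b a a' : EuclideanSpace ℝ (Fin d)} (hp : p ∈ P) (hb : b ∈ P) (ha : a ∈ P)
    (ha' : a' ∈ P) (hpb : p ≠ b) (haa' : a ≠ a') (hab : a ≠ b) (ha'p : a' ≠ p)
    (hxpb : dist x p = dist x b) (hxaa' : dist x a = dist x a') {k : ℝ}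
    (hk : a - a' = k • (p - b)) : a = p := by
  by_contra hap
  set m : EuclideanSpace ℝ (Fin d) := (2⁻¹ : ℝ) • (p + b) with hm
  set u : EuclideanSpace ℝ (Fin d) := (2⁻¹ : ℝ) • (p - b) with hu
  set v : EuclideanSpace ℝ (Fin d) := (2⁻¹ : ℝ) • (a + a') - m with hv
  have hp_eq : p = m + u := by rw [hm, hu]; module
  have hb_eq : b = m - u := by rw [hm, hu]; module
  have hsub : k • u = (2⁻¹ : ℝ) • (a - a') := by rw [hk, hu, smul_comm]
  have ha_eq : a = m + v + k • u := by rw [hsub, hv]; module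
  have ha'_eq : a' = m + v - k • u := by rw [hsub, hv]; module
  have hk0 : k ≠ 0 := by
    rintro rfl
    exact haa' (by simpa [sub_eq_zero] using hk)
  have inner_of_dist : ∀ y w : EuclideanSpace ℝ (Fin d), dist x (y + w) = dist x (y - w) →
      inner ℝ (x - y) w = 0 := by
    intro y w h
    have h1 : ‖x - y - w‖ = ‖x - y + w‖ := by
      rw [dist_eq_norm, dist_eq_norm] at h
      rw [sub_sub, sub_add, h]
    have h2 := norm_sub_sq_real (x - y) w
    rw [h1, norm_add_sq_real] at h2
    linarith
  have h1 : inner ℝ (x - m) u = 0 := inner_of_dist m u (by rwa [← hp_eq, ← hb_eq])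
  have h2 : inner ℝ (x - (m + v)) (k • u) = 0 :=
    inner_of_dist (m + v) (k • u) (by rwa [← ha_eq, ← ha'_eq])
  have huv : inner ℝ u v = 0 := by
    rw [inner_smul_right, mul_eq_zero, or_iff_right hk0, ← sub_sub, inner_sub_left, h1,
      zero_sub, neg_eq_zero] at h2
    rwa [real_inner_comm]
  by_cases hv0 : v = 0
  · refine hgp.1 {p, b, a} (by simp [Set.insert_subset_iff, hp, hb, ha])
      (Set.ncard_eq_three.2 ⟨p, b, a, hpb, Ne.symm hap, hab.symm, rfl⟩) ?_
    rw [collinear_iff_of_mem (p₀ := p) (by simp)]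
    refine ⟨u, ?_⟩
    rintro z (rfl | rfl | rfl)
    · exact ⟨0, by simp⟩
    · exact ⟨-2, by rw [vadd_eq_add, hu]; module⟩
    · exact ⟨k - 1, by
        rw [vadd_eq_add]
        nth_rewrite 1 [ha_eq]
        rw [hp_eq, hv0]
        module⟩
  · have ha'b : a' ≠ b := by
      intro h
      have hvu : v = (k - 1) • u := by
        rw [ha'_eq, hb_eq] at h
        have hv_eq : v = m + v - k • u - m + k • u := by abel
        rw [hv_eq, h]
        module
      have : inner ℝ v v = 0 := by
        nth_rewrite 1 [hvu]
        rw [inner_smul_left, huv, mul_zero]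
      exact hv0 (inner_self_eq_zero.1 this)
    refine hgp.2 {p, b, a, a'} (by simp [Set.insert_subset_iff, hp, hb, ha, ha']) ?_ ?_
    · rw [Set.ncard_insert_of_notMem (by simp [hpb, Ne.symm hap, ha'p.symm]),
        Set.ncard_eq_three.2 ⟨b, a, a', hab.symm, ha'b.symm, haa', rfl⟩]
    · rw [hp_eq, hb_eq, ha_eq, ha'_eq]
      exact concyclic_isosceles_trapezoid huv hv0 k

theorem dist_add_smul_sq {V : Type*} [NormedAddCommGroup V] [InnerProductSpace ℝ V]
    (x w u : V) (t : ℝ) :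
    dist (x + t • w) u ^ 2 =
      dist x u ^ 2 + 2 * t * (inner ℝ x w - inner ℝ u w) + ‖t • w‖ ^ 2 := by
  rw [dist_eq_norm, dist_eq_norm, add_sub_right_comm, norm_add_sq_real, inner_smul_right,
    inner_sub_left]
  ring

/-- If finitely many bisectors through `x` meet every line through `x` orthogonal to `e` in a
point other than `x`, then one of them is orthogonal to `e` (or degenerate). -/
theorem exists_sub_eq_smul_of_forall_dist_eq {V : Type*} [NormedAddCommGroup V]
    [InnerProductSpace ℝ V] [CompleteSpace V] {S : Set (V × V)} (hS : S.Finite) {x e : V}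
    (h : ∀ w, inner ℝ e w = 0 → ∃ t : ℝ, t ≠ 0 ∧ ∃ z ∈ S,
      dist x z.1 = dist x z.2 ∧ dist (x + t • w) z.1 = dist (x + t • w) z.2) :
    ∃ z ∈ S, dist x z.1 = dist x z.2 ∧ ∃ k : ℝ, z.1 - z.2 = k • e := by
  set T : Set (V × V) := {z | z ∈ S ∧ dist x z.1 = dist x z.2} with hT
  have : Finite T := (hS.subset fun z hz => hz.1).to_subtype
  let W : Submodule ℝ V := (ℝ ∙ e)ᗮ
  have hcov : ⋃ z : T, (((ℝ ∙ (z.1.1 - z.1.2))ᗮ.comap W.subtype : Submodule ℝ W) : Set W) =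
      Set.univ := by
    refine Set.eq_univ_of_forall fun w => ?_
    obtain ⟨t, ht, z, hz, hxz, hyz⟩ := h w
      (Submodule.mem_orthogonal_singleton_iff_inner_right.1 w.2)
    refine Set.mem_iUnion.2 ⟨⟨z, hz, hxz⟩, ?_⟩
    change (w : V) ∈ (ℝ ∙ (z.1 - z.2))ᗮ
    rw [Submodule.mem_orthogonal_singleton_iff_inner_right]
    have h1 := dist_add_smul_sq x w z.1 t
    rw [hyz, hxz, dist_add_smul_sq] at h1
    have h2 : t * inner ℝ (z.1 - z.2) (w : V) = 0 := by
      rw [inner_sub_left]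
      linarith
    exact (mul_eq_zero.1 h2).resolve_left ht
  obtain ⟨z, hz⟩ := Subspace.exists_eq_top_of_iUnion_eq_univ hcov
  refine ⟨z.1, z.2.1, z.2.2, ?_⟩
  have hle : (ℝ ∙ e)ᗮ ≤ (ℝ ∙ (z.1.1 - z.1.2))ᗮ := fun w hw => by
    have : (⟨w, hw⟩ : W) ∈ (ℝ ∙ (z.1.1 - z.1.2))ᗮ.comap W.subtype := hz ▸ Submodule.mem_top
    exact this
  have hmem : z.1.1 - z.1.2 ∈ ℝ ∙ e := by
    rw [← Submodule.orthogonal_orthogonal (ℝ ∙ e)]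
    exact Submodule.orthogonal_le hle
      (Submodule.le_orthogonal_orthogonal _ (Submodule.mem_span_singleton_self _))
  obtain ⟨k, hk⟩ := Submodule.mem_span_singleton.1 hmem
  exact ⟨k, hk.symm⟩

/-- For a finite nonempty labelled point set in general position, every reduced
training set contains every relevant point. -/
theorem relPts_subset_RTS {d : ℕ} (hd : 1 ≤ d) {L : Type*}
    (P : Set (EuclideanSpace ℝ (Fin d))) (c : EuclideanSpace ℝ (Fin d) → L)
    (hfin : P.Finite) (hne : P.Nonempty) (hgp : GenPos P)
    (Q : Set (EuclideanSpace ℝ (Fin d))) (hQ : IsRTS P c Q) :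
    relPts P c ⊆ Q := by
  intro p hp
  by_contra hpQ
  obtain ⟨hQP, hQc⟩ := hQ
  have himage : ∀ y, c '' nearestPts Q y = c '' nearestPts P y := fun y => by
    rw [← nnClass_eq_image, ← nnClass_eq_image, hQc]
  have hQne : Q.Nonempty := by
    have h := (nearestPts_nonempty hfin hne p).image c
    rw [← himage] at h
    exact h.of_image.mono fun a ha => ha.1
  obtain ⟨x, b, hb, hcb, hxpb, hx⟩ := exists_wall_of_mem_relPts hfin hp
    (hQne.mono fun a ha => ⟨hQP ha, fun h => hpQ (h ▸ ha)⟩)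
  have hpb : p ≠ b := fun h => hcb (by rw [h])
  have hnear : nearestPts P x ⊆ {p, b} := fun a ha => by
    by_contra! hab
    simp only [Set.mem_insert_iff, Set.mem_singleton_iff, not_or] at hab
    exact absurd (ha.2 b hb) (not_le.2 (hx a ha.1 hab.1 hab.2))
  have hQfin : Q.Finite := hfin.subset hQP
  obtain ⟨z, ⟨hz1, hz2, hcz1, hcz2⟩, hxz, k, hk⟩ := exists_sub_eq_smul_of_forall_dist_eq
      (S := {z | z.1 ∈ Q ∧ z.2 ∈ Q ∧ c z.1 = c p ∧ c z.2 = c b})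
      ((hQfin.prod hQfin).subset fun z hz => ⟨hz.1, hz.2.1⟩) (x := x) (e := p - b) (by
    intro w hw
    have htend : Tendsto (fun t : ℝ => x + t • w) (𝓝[≠] 0) (𝓝 x) := by
      have h : Continuous fun t : ℝ => x + t • w := by fun_prop
      have h0 := h.tendsto 0
      rw [zero_smul, add_zero] at h0
      exact h0.mono_left nhdsWithin_le_nhds
    obtain ⟨t, ⟨hPy, hQy⟩, ht⟩ := ((htend.eventually
      ((eventually_nearestPts_subset hfin x).and (eventually_nearestPts_subset hQfin x))).and
      self_mem_nhdsWithin).exists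
    have hypb : dist (x + t • w) p = dist (x + t • w) b := by
      rw [inner_sub_left, sub_eq_zero] at hw
      rw [← sq_eq_sq₀ dist_nonneg dist_nonneg, dist_add_smul_sq, dist_add_smul_sq,
        hxpb, hw]
    obtain ⟨n, hn⟩ := nearestPts_nonempty hfin hne (x + t • w)
    have hmin : ∀ p' ∈ P, dist (x + t • w) p ≤ dist (x + t • w) p' := by
      rcases hnear (hPy hn) with rfl | rfl
      · exact hn.2
      · rw [hypb]
        exact hn.2
    obtain ⟨a, ha, hca⟩ : c p ∈ c '' nearestPts Q (x + t • w) :=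
      himage _ ▸ ⟨p, ⟨hp.1, hmin⟩, rfl⟩
    obtain ⟨a', ha', hca'⟩ : c b ∈ c '' nearestPts Q (x + t • w) :=
      himage _ ▸ ⟨b, ⟨hb, hypb ▸ hmin⟩, rfl⟩
    exact ⟨t, ht, (a, a'), ⟨ha.1, ha'.1, hca, hca'⟩,
      le_antisymm ((hQy ha).2 _ ha'.1) ((hQy ha').2 _ ha.1),
      le_antisymm (ha.2 _ ha'.1) (ha'.2 _ ha.1)⟩)
  have heq : z.1 = p := hgp.eq_of_parallel hp.1 hb (hQP hz1) (hQP hz2) hpb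
    (fun h => hcb (by rw [← hcz1, ← hcz2, h])) (fun h => hcb (by rw [← hcz1, h]))
    (fun h => hcb (by rw [← hcz2, h])) hxpb hxz hk
  exact hpQ (heq ▸ hz1)
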